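/- Let k ≥ 2, let γ : Fin k → I be any tuple of indices, let β ∈ I, and let m be an integer with m ≥ 0. For each (r,s) ∈ ℤ^k × ℤ with r(0)+⋯+r(k−1)+s = m, define the normally ordered monomial applied to the vacuum: P(r,s) := a*(γ(0),r(0))⋯a*(γ(k−1),r(k−1))·a(β,s)·u_n if s ≥ 0, and P(r,s) := a(β,s)·a*(γ(0),r(0))⋯a*(γ(k−1),r(k−1))·u_n if s < 0. Then the family P(r,s) has finite support and ∑ P(r,s) = 0 in M_n. (By linearity this is Lemma: for any polynomial T in the fields a*_γ(z) with no constant and no linear terms, [:T(a*(z)) a_β(z):]_m · u_n = 0 for all m ≥ 0; the paper's proof treats the quadratic case T = a*_α(z)a*_γ(z).) -/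

import Mathlib

noncomputable section

/-- Generators of the infinite-dimensional Weyl algebra: `a γ r` and `as γ r`
(the latter playing the role of `a*(γ,r)`), for `γ ∈ I`, `r ∈ ℤ`. -/
inductive WGen (I : Type) : Type
  | a : I → ℤ → WGen I
  | as : I → ℤ → WGen I

open FreeAlgebra in
/-- The defining relations of the infinite-dimensional Weyl algebra `𝒜`:
`a(γ,r)·a*(δ,s) − a*(δ,s)·a(γ,r) = (1 if γ = δ and r = −s, else 0)`, while the `a`'s
commute among themselves and the `a*`'s commute among themselves. -/
inductive WeylRel (I : Type) : FreeAlgebra ℂ (WGen I) → FreeAlgebra ℂ (WGen I) → Prop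
  | a_as_eq (γ : I) (r : ℤ) :
      WeylRel I (ι ℂ (WGen.a γ r) * ι ℂ (WGen.as γ (-r)))
        (ι ℂ (WGen.as γ (-r)) * ι ℂ (WGen.a γ r) + 1)
  | a_as_ne (γ δ : I) (r s : ℤ) (h : γ ≠ δ ∨ r ≠ -s) :
      WeylRel I (ι ℂ (WGen.a γ r) * ι ℂ (WGen.as δ s))
        (ι ℂ (WGen.as δ s) * ι ℂ (WGen.a γ r))
  | a_a (γ δ : I) (r s : ℤ) :
      WeylRel I (ι ℂ (WGen.a γ r) * ι ℂ (WGen.a δ s))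
        (ι ℂ (WGen.a δ s) * ι ℂ (WGen.a γ r))
  | as_as (γ δ : I) (r s : ℤ) :
      WeylRel I (ι ℂ (WGen.as γ r) * ι ℂ (WGen.as δ s))
        (ι ℂ (WGen.as δ s) * ι ℂ (WGen.as γ r))

/-- The infinite-dimensional Weyl algebra `𝒜`: the quotient of the free ℂ-algebra on
the generators `a(γ,r)`, `a*(γ,r)` by the two-sided ideal generated by the relations. -/
abbrev WeylAlg (I : Type) : Type := RingQuot (WeylRel I)

/-- The generator `a(γ,r)` of `𝒜`. -/
def wa {I : Type} (γ : I) (r : ℤ) : WeylAlg I :=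
  RingQuot.mkAlgHom ℂ (WeylRel I) (FreeAlgebra.ι ℂ (WGen.a γ r))

/-- The generator `a*(γ,r)` of `𝒜`. -/
def was {I : Type} (γ : I) (r : ℤ) : WeylAlg I :=
  RingQuot.mkAlgHom ℂ (WeylRel I) (FreeAlgebra.ι ℂ (WGen.as γ r))

/-- The left ideal of `𝒜` generated by the `a(γ,r)` with `r ≥ n` and the
`a*(γ,r)` with `r ≥ 1 − n`. -/
def fockIdeal (I : Type) (n : ℕ) : Submodule (WeylAlg I) (WeylAlg I) :=
  Submodule.span (WeylAlg I)
    ({x | ∃ γ : I, ∃ r : ℤ, (n : ℤ) ≤ r ∧ x = wa γ r} ∪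
     {x | ∃ γ : I, ∃ r : ℤ, 1 - (n : ℤ) ≤ r ∧ x = was γ r})

/-- The Fock module `M_n = 𝒜 / 𝒜·(a(γ,r) : r ≥ n, a*(γ,r) : r ≥ 1−n)`,
a left `𝒜`-module. -/
abbrev Fock (I : Type) (n : ℕ) : Type := WeylAlg I ⧸ fockIdeal I n

/-- The vacuum vector `u_n ∈ M_n`, the image of `1 ∈ 𝒜`. -/
def fockVac (I : Type) (n : ℕ) : Fock I n := Submodule.Quotient.mk 1


/-- The normally ordered monomial `:a*(γ 0, r 0)⋯a*(γ (k−1), r (k−1)) a(β,s):` applied to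
the vacuum `u_n`: the annihilation operator `a(β,s)` is placed to the right when `s ≥ 0`
and to the left when `s < 0`. -/
def nordTerm {I : Type} (n : ℕ) {k : ℕ} (γ : Fin k → I) (β : I)
    (rs : (Fin k → ℤ) × ℤ) : Fock I n :=
  if 0 ≤ rs.2 then
    ((List.ofFn fun i => was (γ i) (rs.1 i)).prod * wa β rs.2) • fockVac I n
  else
    (wa β rs.2 * (List.ofFn fun i => was (γ i) (rs.1 i)).prod) • fockVac I n

theorem was_commute {I : Type} (γ δ : I) (r s : ℤ) : Commute (was γ r) (was δ s) := by
  have h := RingQuot.mkAlgHom_rel ℂ (WeylRel.as_as γ δ r s)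
  simp only [map_mul] at h
  exact h

theorem wa_commute_was {I : Type} {γ δ : I} {r s : ℤ} (h : γ ≠ δ ∨ r ≠ -s) :
    Commute (wa γ r) (was δ s) := by
  have h := RingQuot.mkAlgHom_rel ℂ (WeylRel.a_as_ne γ δ r s h)
  simp only [map_mul] at h
  exact h

theorem wa_mul_was_neg {I : Type} (γ : I) (r : ℤ) :
    wa γ r * was γ (-r) = was γ (-r) * wa γ r + 1 := by
  have h := RingQuot.mkAlgHom_rel ℂ (WeylRel.a_as_eq γ r)
  simp only [map_mul, map_add, map_one] at h
  exact h

theorem smul_fockVac_eq_zero_of_mem {I : Type} {n : ℕ} {x : WeylAlg I}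
    (hx : x ∈ fockIdeal I n) : x • fockVac I n = 0 := by
  rw [fockVac, ← Submodule.Quotient.mk_smul, smul_eq_mul, mul_one]
  exact (Submodule.Quotient.mk_eq_zero _).2 hx

theorem wa_smul_fockVac {I : Type} {n : ℕ} (γ : I) {r : ℤ} (hr : (n : ℤ) ≤ r) :
    wa γ r • fockVac I n = 0 :=
  smul_fockVac_eq_zero_of_mem (Submodule.subset_span (Or.inl ⟨γ, r, hr, rfl⟩))

theorem was_smul_fockVac {I : Type} {n : ℕ} (γ : I) {r : ℤ} (hr : 1 - (n : ℤ) ≤ r) :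
    was γ r • fockVac I n = 0 :=
  smul_fockVac_eq_zero_of_mem (Submodule.subset_span (Or.inr ⟨γ, r, hr, rfl⟩))

/-- The creation operators commute, so any chosen factor can be moved to the far right. -/
theorem prod_map_was_eq_erase_mul {I ι : Type} [DecidableEq ι] (γ : ι → I) (r : ι → ℤ)
    {l : List ι} {i : ι} (hi : i ∈ l) :
    (l.map fun j => was (γ j) (r j)).prod =
      ((l.erase i).map fun j => was (γ j) (r j)).prod * was (γ i) (r i) := by
  have hperm : (l.map fun j => was (γ j) (r j)).Perm
      ((i :: l.erase i).map fun j => was (γ j) (r j)) :=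
    (List.perm_cons_erase hi).map _
  have hcomm : (l.map fun j => was (γ j) (r j)).Pairwise Commute :=
    List.pairwise_map.2 (List.pairwise_of_forall fun _ _ => was_commute _ _ _ _)
  rw [hperm.prod_eq' hcomm, List.map_cons, List.prod_cons]
  refine (Commute.list_prod_right _ _ fun x hx => ?_).eq
  obtain ⟨j, -, rfl⟩ := List.mem_map.1 hx
  exact was_commute _ _ _ _

theorem prod_map_was_smul_fockVac {I ι : Type} [DecidableEq ι] {n : ℕ} (γ : ι → I) (r : ι → ℤ)
    {l : List ι} {i : ι} (hi : i ∈ l) (hr : 1 - (n : ℤ) ≤ r i) :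
    (l.map fun j => was (γ j) (r j)).prod • fockVac I n = 0 := by
  rw [prod_map_was_eq_erase_mul γ r hi, mul_smul, was_smul_fockVac _ hr, smul_zero]

theorem was_smul_wa_smul_fockVac {I : Type} {n : ℕ} {γ β : I} {r s : ℤ}
    (hr : 1 - (n : ℤ) ≤ r) (h : β ≠ γ ∨ s ≠ -r) :
    was γ r • wa β s • fockVac I n = 0 := by
  rw [← mul_smul, ← (wa_commute_was h).eq, mul_smul, was_smul_fockVac _ hr, smul_zero]

theorem was_neg_smul_wa_smul_fockVac {I : Type} {n : ℕ} (β : I) {s : ℤ}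
    (hs : 1 - (n : ℤ) ≤ -s) :
    was β (-s) • wa β s • fockVac I n = -fockVac I n := by
  rw [← mul_smul, ← sub_eq_iff_eq_add.2 (wa_mul_was_neg β s), sub_smul, mul_smul,
    was_smul_fockVac _ hs, smul_zero, one_smul, zero_sub]

/-- Every normally ordered monomial of mode `m ≥ 0` with at least two creation factors
annihilates the vacuum. -/
theorem nordTerm_eq_zero {I : Type} {n : ℕ} (hn : 1 ≤ n) {k : ℕ} (hk : 2 ≤ k)
    (γ : Fin k → I) (β : I) {rs : (Fin k → ℤ) × ℤ} (h : 0 ≤ (∑ i, rs.1 i) + rs.2) :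
    nordTerm n γ β rs = 0 := by
  obtain ⟨r, s⟩ := rs
  simp only at h
  rw [nordTerm, List.ofFn_eq_map]
  by_cases hsn : (n : ℤ) ≤ s
  · rw [if_pos (by simp only; omega), mul_smul, wa_smul_fockVac β hsn, smul_zero]
  have hex : ∃ i, 1 - (n : ℤ) ≤ r i := by
    by_contra! hlt
    have hsum : ∑ i, r i ≤ ∑ _i : Fin k, (-(n : ℤ)) :=
      Finset.sum_le_sum fun i _ => by have := hlt i; omega
    rw [Finset.sum_const, Finset.card_univ, Fintype.card_fin, nsmul_eq_mul] at hsum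
    have hk' : (2 : ℤ) ≤ k := by exact_mod_cast hk
    nlinarith
  obtain ⟨i, hi⟩ := hex
  split_ifs with hs
  · rw [prod_map_was_eq_erase_mul γ r (List.mem_finRange i), mul_smul, mul_smul]
    by_cases hc : β ≠ γ i ∨ s ≠ -r i
    · rw [was_smul_wa_smul_fockVac hi hc, smul_zero]
    push Not at hc
    obtain ⟨rfl, rfl⟩ := hc
    have hj : ∃ j ∈ Finset.univ.erase i, 0 ≤ r j := by
      have hsum := Finset.add_sum_erase Finset.univ r (Finset.mem_univ i)
      have hne : (Finset.univ.erase i).Nonempty := by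
        rw [← Finset.card_pos, Finset.card_erase_of_mem (Finset.mem_univ i), Finset.card_univ,
          Fintype.card_fin]
        omega
      by_contra! hlt
      have := Finset.sum_neg hlt hne
      omega
    obtain ⟨j, hji, hj⟩ := hj
    have hmem : j ∈ (List.finRange k).erase i :=
      (List.mem_erase_of_ne (Finset.ne_of_mem_erase hji)).2 (List.mem_finRange j)
    have hvac := was_neg_smul_wa_smul_fockVac (n := n) (γ i) (s := -r i) (by omega)
    rw [neg_neg] at hvac
    rw [hvac, smul_neg, prod_map_was_smul_fockVac γ r hmem (by omega), neg_zero]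
  · rw [mul_smul, prod_map_was_smul_fockVac γ r (List.mem_finRange i) hi, smul_zero]

/-!
STATEMENT 5: for `k ≥ 2`, any `γ : Fin k → I`, `β ∈ I` and any integer `m ≥ 0`, the
family of normally ordered monomials `P(r,s)` applied to the vacuum, indexed by those
`(r,s) ∈ ℤ^k × ℤ` with `r 0 + ⋯ + r (k−1) + s = m`, has finite support and sums to `0`
in `M_n`; i.e. `[:T(a*(z)) a_β(z):]_m · u_n = 0` for every polynomial `T` in the fields
`a*_γ(z)` with no constant and no linear terms, for all `m ≥ 0`.
-/
theorem nord_mode_on_vacuum_of_quadratic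
    (n : ℕ) (hn : 1 ≤ n) (I : Type) (k : ℕ) (hk : 2 ≤ k) (γ : Fin k → I) (β : I)
    (m : ℤ) (hm : 0 ≤ m) :
    (Function.support (fun rs : (Fin k → ℤ) × ℤ =>
        if (∑ i, rs.1 i) + rs.2 = m then nordTerm n γ β rs else 0)).Finite ∧
    (∑ᶠ rs : (Fin k → ℤ) × ℤ,
        (if (∑ i, rs.1 i) + rs.2 = m then nordTerm n γ β rs else 0)) = 0 := by
  have hzero : ∀ rs : (Fin k → ℤ) × ℤ,
      (if (∑ i, rs.1 i) + rs.2 = m then nordTerm n γ β rs else 0) = 0 := fun rs =>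
    ite_eq_right_iff.2 fun h => nordTerm_eq_zero hn hk γ β (h ▸ hm)
  simp [hzero]

end
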